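/- Let n1, n2 ≥ 1 and, for i = 1,…,k, let A(i) be the (n1+n2)×(n1+n2) block matrix over ℝ ∪ {-∞} with upper-left n1×n1 block D1(i), upper-right n1×n2 block T(i), lower-left block identically -∞, and lower-right n2×n2 block D2(i). Let A_k = A(1) ⊗ ⋯ ⊗ A(k) and, for l ≤ m, write D1(l,m) = D1(l) ⊗ ⋯ ⊗ D1(m) and D2(l,m) = D2(l) ⊗ ⋯ ⊗ D2(m), with empty products equal to the max-plus identity matrix (whose norm is 0); set D_{1k} = D1(1,k) and D_{2k} = D2(1,k). Then the following two-sided bound holds in ℝ ∪ {-∞}: max(‖D_{1k}‖, ‖D_{2k}‖) ≤ ‖A_k‖ ≤ max( ‖D_{1k}‖, ‖D_{2k}‖, max_{1≤j≤k} ‖T(j)‖ + max_{1≤i≤k} ( ‖D1(1,i-1)‖ + ‖D2(i+1,k)‖ ) ). -/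

import Mathlib

/- Max-plus algebra over `ℝ ∪ {-∞}`, modelled as `WithBot ℝ`. -/

/-- Max-plus product of (possibly rectangular) matrices over `ℝ ∪ {-∞}`. -/
noncomputable def mpMul {ι κ σ : Type*} [Fintype κ]
    (A : ι → κ → WithBot ℝ) (B : κ → σ → WithBot ℝ) : ι → σ → WithBot ℝ :=
  fun i j => Finset.univ.sup fun k => A i k + B k j

/-- Max-plus identity matrix. -/
noncomputable def mpId {ι : Type*} [DecidableEq ι] : ι → ι → WithBot ℝ :=
  fun i j => if i = j then (0 : WithBot ℝ) else ⊥

/-- Norm of a matrix over `ℝ ∪ {-∞}`: its maximum entry (possibly `-∞`). -/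
noncomputable def mpNorm {ι κ : Type*} [Fintype ι] [Fintype κ]
    (A : ι → κ → WithBot ℝ) : WithBot ℝ :=
  Finset.univ.sup fun i => Finset.univ.sup fun j => A i j

/-- `mpProdFrom A l len = A(l) ⊗ A(l+1) ⊗ ⋯ ⊗ A(l+len-1)`, the max-plus product of `len`
consecutive matrices starting at index `l`; the empty product (`len = 0`) is the identity.
Thus the product `A(l) ⊗ ⋯ ⊗ A(m)` is `mpProdFrom A l (m + 1 - l)`. -/
noncomputable def mpProdFrom {ι : Type*} [Fintype ι] [DecidableEq ι]
    (A : ℕ → ι → ι → WithBot ℝ) (l : ℕ) : ℕ → ι → ι → WithBot ℝ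
  | 0 => mpId
  | len + 1 => mpMul (mpProdFrom A l len) (A (l + len))

/-- The block matrix with upper-left block `D1 i`, upper-right block `T i`, lower-left block
identically `-∞`, and lower-right block `D2 i`. -/
noncomputable def blockMat {n1 n2 : ℕ} (D1 : ℕ → Fin n1 → Fin n1 → WithBot ℝ)
    (T : ℕ → Fin n1 → Fin n2 → WithBot ℝ) (D2 : ℕ → Fin n2 → Fin n2 → WithBot ℝ)
    (i : ℕ) : (Fin n1 ⊕ Fin n2) → (Fin n1 ⊕ Fin n2) → WithBot ℝ
  | Sum.inl p, Sum.inl q => D1 i p q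
  | Sum.inl p, Sum.inr q => T i p q
  | Sum.inr _, Sum.inl _ => ⊥
  | Sum.inr p, Sum.inr q => D2 i p q

theorem le_mpMul {ι κ σ : Type*} [Fintype κ] (A : ι → κ → WithBot ℝ) (B : κ → σ → WithBot ℝ)
    (i : ι) (r : κ) (j : σ) : A i r + B r j ≤ mpMul A B i j :=
  Finset.le_sup (f := fun r => A i r + B r j) (Finset.mem_univ r)

theorem exists_mpMul_eq {ι κ σ : Type*} [Fintype κ] [Nonempty κ] (A : ι → κ → WithBot ℝ)
    (B : κ → σ → WithBot ℝ) (i : ι) (j : σ) : ∃ r, mpMul A B i j = A i r + B r j := by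
  obtain ⟨r, -, h⟩ := Finset.exists_mem_eq_sup Finset.univ Finset.univ_nonempty
    fun r => A i r + B r j
  exact ⟨r, h⟩

theorem le_mpNorm {ι κ : Type*} [Fintype ι] [Fintype κ] (A : ι → κ → WithBot ℝ) (i : ι) (j : κ) :
    A i j ≤ mpNorm A :=
  (Finset.le_sup (f := A i) (Finset.mem_univ j)).trans
    (Finset.le_sup (f := fun i => Finset.univ.sup (A i)) (Finset.mem_univ i))

theorem mpNorm_le {ι κ : Type*} [Fintype ι] [Fintype κ] {A : ι → κ → WithBot ℝ} {c : WithBot ℝ}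
    (h : ∀ i j, A i j ≤ c) : mpNorm A ≤ c :=
  Finset.sup_le fun i _ => Finset.sup_le fun j _ => h i j

theorem mpMul_sum {ι κ₁ κ₂ σ : Type*} [Fintype κ₁] [Fintype κ₂]
    (A : ι → κ₁ ⊕ κ₂ → WithBot ℝ) (B : κ₁ ⊕ κ₂ → σ → WithBot ℝ) (i : ι) (j : σ) :
    mpMul A B i j =
      (Finset.univ.sup fun r => A i (Sum.inl r) + B (Sum.inl r) j) ⊔
        Finset.univ.sup fun r => A i (Sum.inr r) + B (Sum.inr r) j := by
  refine le_antisymm (Finset.sup_le ?_) (sup_le (Finset.sup_le fun r _ => le_mpMul A B i _ j)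
    (Finset.sup_le fun r _ => le_mpMul A B i _ j))
  rintro (r | r) -
  · exact le_sup_of_le_left
      (Finset.le_sup (f := fun r => A i (Sum.inl r) + B (Sum.inl r) j) (Finset.mem_univ r))
  · exact le_sup_of_le_right
      (Finset.le_sup (f := fun r => A i (Sum.inr r) + B (Sum.inr r) j) (Finset.mem_univ r))

theorem mpProdFrom_succ {ι : Type*} [Fintype ι] [DecidableEq ι] (A : ℕ → ι → ι → WithBot ℝ)
    (l n : ℕ) : mpProdFrom A l (n + 1) = mpMul (mpProdFrom A l n) (A (l + n)) :=
  rfl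

section BlockMat

variable {n1 n2 : ℕ} (D1 : ℕ → Fin n1 → Fin n1 → WithBot ℝ)
  (T : ℕ → Fin n1 → Fin n2 → WithBot ℝ) (D2 : ℕ → Fin n2 → Fin n2 → WithBot ℝ) (l : ℕ)

theorem mpProdFrom_blockMat_inr_inl (n : ℕ) (p : Fin n2) (q : Fin n1) :
    mpProdFrom (blockMat D1 T D2) l n (Sum.inr p) (Sum.inl q) = ⊥ := by
  induction n generalizing q with
  | zero => simp [mpProdFrom, mpId]
  | succ n ih => simp [mpProdFrom, mpMul_sum, blockMat, ih]

theorem mpProdFrom_blockMat_inl_inl (n : ℕ) (p q : Fin n1) :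
    mpProdFrom (blockMat D1 T D2) l n (Sum.inl p) (Sum.inl q) = mpProdFrom D1 l n p q := by
  induction n generalizing q with
  | zero => simp [mpProdFrom, mpId]
  | succ n ih =>
    simp only [mpProdFrom, mpMul_sum, ih]
    simp [blockMat, mpMul]

theorem mpProdFrom_blockMat_inr_inr (n : ℕ) (p q : Fin n2) :
    mpProdFrom (blockMat D1 T D2) l n (Sum.inr p) (Sum.inr q) = mpProdFrom D2 l n p q := by
  induction n generalizing q with
  | zero => simp [mpProdFrom, mpId]
  | succ n ih =>
    simp only [mpProdFrom, mpMul_sum, mpProdFrom_blockMat_inr_inl, ih]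
    simp [blockMat, mpMul]

/-- A finite entry of the upper-right block comes from a path that uses exactly one `T`. -/
theorem mpProdFrom_blockMat_inl_inr_le (n : ℕ) (p : Fin n1) (q : Fin n2) :
    mpProdFrom (blockMat D1 T D2) l n (Sum.inl p) (Sum.inr q) = ⊥ ∨
      ∃ m s r, m + 1 + s = n ∧ mpProdFrom (blockMat D1 T D2) l n (Sum.inl p) (Sum.inr q) ≤
        mpNorm (T (l + m)) + (mpNorm (mpProdFrom D1 l m) +
          mpProdFrom D2 (l + m + 1) s r q) := by
  induction n generalizing q with
  | zero => simp [mpProdFrom, mpId]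
  | succ n ih =>
    have : Nonempty (Fin n1 ⊕ Fin n2) := ⟨Sum.inl p⟩
    obtain ⟨r | r, hr⟩ := exists_mpMul_eq (mpProdFrom (blockMat D1 T D2) l n)
      (blockMat D1 T D2 (l + n)) (Sum.inl p) (Sum.inr q)
    · refine Or.inr ⟨n, 0, q, rfl, ?_⟩
      rw [mpProdFrom_succ, hr, mpProdFrom_blockMat_inl_inl, add_comm]
      simpa [mpProdFrom, mpId, blockMat] using
        add_le_add (le_mpNorm (T (l + n)) r q) (le_mpNorm (mpProdFrom D1 l n) p r)
    · rw [mpProdFrom_succ, hr]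
      obtain h | ⟨m, s, r', rfl, h⟩ := ih r
      · simp [h]
      · refine Or.inr ⟨m, s + 1, r', rfl, (add_le_add_left h _).trans ?_⟩
        rw [add_assoc, add_assoc, ← add_assoc l, ← add_assoc l]
        gcongr
        exact le_mpMul (mpProdFrom D2 (l + m + 1) s) (D2 (l + m + 1 + s)) r' r q

end BlockMat

/-- For block triangular matrices `A(i)` (`i = 1,…,k`) as above, with
`A_k = A(1) ⊗ ⋯ ⊗ A(k)`, `D_{1k} = D1(1) ⊗ ⋯ ⊗ D1(k)`, `D_{2k} = D2(1) ⊗ ⋯ ⊗ D2(k)`,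
the two-sided bound holds in `ℝ ∪ {-∞}`:
`max(‖D_{1k}‖, ‖D_{2k}‖) ≤ ‖A_k‖ ≤ max(‖D_{1k}‖, ‖D_{2k}‖,
  max_{1≤j≤k} ‖T(j)‖ + max_{1≤i≤k} (‖D1(1,i-1)‖ + ‖D2(i+1,k)‖))`. -/
theorem stmt_4 {n1 n2 : ℕ} (hn1 : 1 ≤ n1) (hn2 : 1 ≤ n2) (k : ℕ) (hk : 1 ≤ k)
    (D1 : ℕ → Fin n1 → Fin n1 → WithBot ℝ)
    (T : ℕ → Fin n1 → Fin n2 → WithBot ℝ)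
    (D2 : ℕ → Fin n2 → Fin n2 → WithBot ℝ) :
    mpNorm (mpProdFrom D1 1 k) ⊔ mpNorm (mpProdFrom D2 1 k)
        ≤ mpNorm (mpProdFrom (blockMat D1 T D2) 1 k) ∧
    mpNorm (mpProdFrom (blockMat D1 T D2) 1 k)
        ≤ (mpNorm (mpProdFrom D1 1 k) ⊔ mpNorm (mpProdFrom D2 1 k)) ⊔
          (((Finset.Icc 1 k).sup fun j => mpNorm (T j)) +
            (Finset.Icc 1 k).sup fun i =>
              mpNorm (mpProdFrom D1 1 (i - 1)) + mpNorm (mpProdFrom D2 (i + 1) (k - i))) := by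
  refine ⟨sup_le (mpNorm_le fun p q => ?_) (mpNorm_le fun p q => ?_), mpNorm_le ?_⟩
  · rw [← mpProdFrom_blockMat_inl_inl D1 T D2]
    exact le_mpNorm _ _ _
  · rw [← mpProdFrom_blockMat_inr_inr D1 T D2]
    exact le_mpNorm _ _ _
  rintro (p | p) (q | q)
  · rw [mpProdFrom_blockMat_inl_inl]
    exact le_sup_of_le_left (le_sup_of_le_left (le_mpNorm _ _ _))
  · obtain h | ⟨m, s, r, rfl, h⟩ := mpProdFrom_blockMat_inl_inr_le D1 T D2 1 k p q
    · simp [h]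
    · have hm : 1 + m ∈ Finset.Icc 1 (m + 1 + s) := by
        rw [Finset.mem_Icc]
        omega
      refine le_sup_of_le_right (h.trans (add_le_add
        (Finset.le_sup (f := fun j => mpNorm (T j)) hm) ?_))
      refine Finset.le_sup_of_le hm ?_
      rw [show 1 + m - 1 = m by omega, show m + 1 + s - (1 + m) = s by omega]
      gcongr
      exact le_mpNorm _ _ _
  · simp [mpProdFrom_blockMat_inr_inl]
  · rw [mpProdFrom_blockMat_inr_inr]
    exact le_sup_of_le_left (le_sup_of_le_right (le_mpNorm _ _ _))
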